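/- arXiv:2411.12272 — 3 statements merged into one kernel-verified Lean document; each statement's English description precedes it below -/
import Mathlib

section
/- Let π be a Borel probability measure on (0,∞), w ∈ [0,1], M₁ ∈ (0,1), T > 0, and let E : [0,T] × (0,∞) → ℝ be a measurable function with sup_{0≤t≤T} ∫₀^∞ |E(t,r)| π(dr) < ∞ satisfying, for every t ∈ [0,T] and π-almost every r > 0, E(t,r) = e^{−(1−wM₁) r t} + (1−w) M₁ r ∫₀ᵗ e^{−(1−wM₁) r (t−s)} ( ∫₀^∞ E(s,y) π(dy) ) ds. Then sup_{0≤t≤T} ∫₀^∞ |E(t,r)| π(dr) ≤ (1−wM₁)/(1−M₁). -/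
open MeasureTheory

/-- The operator associated with the mild form of the first Lyapunov equation of the
aggregation model. -/
noncomputable def lyapOp (π : Measure ℝ) (w M₁ : ℝ)
    (Φ : ℝ → ℝ → ℝ) (t r : ℝ) : ℝ :=
  Real.exp (-((1 - w * M₁) * r * t)) +
    (1 - w) * M₁ * r *
      ∫ s in (0:ℝ)..t, Real.exp (-((1 - w * M₁) * r * (t - s))) *
        (∫ y in Set.Ioi (0:ℝ), Φ s y ∂π)

/-- The exponential kernel of the mild form has total mass at most one. -/
lemma integral_mul_exp_neg_le_one (c t : ℝ) :
    ∫ s in (0:ℝ)..t, c * Real.exp (-(c * (t - s))) ≤ 1 := by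
  have hderiv : ∀ s ∈ Set.uIcc 0 t, HasDerivAt (fun s => Real.exp (-(c * (t - s))))
      (c * Real.exp (-(c * (t - s)))) s := by
    intro s _
    have h := ((((hasDerivAt_id s).const_sub t).const_mul c).neg).exp
    refine h.congr_deriv ?_
    simp only [Pi.neg_apply, id_eq]
    ring
  have hcont : Continuous fun s => c * Real.exp (-(c * (t - s))) := by fun_prop
  rw [intervalIntegral.integral_eq_sub_of_hasDerivAt hderiv (hcont.intervalIntegrable 0 t)]
  simp [Real.exp_nonneg]

/-- A pointwise bound on `lyapOp` in terms of a bound on the mass of its argument. -/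
lemma abs_lyapOp_le {π : Measure ℝ} {w M₁ : ℝ} (hw : w ≤ 1) (hM₁ : 0 ≤ M₁)
    (ha : 0 < 1 - w * M₁) {Φ : ℝ → ℝ → ℝ} {S t r : ℝ} (ht : 0 ≤ t) (hr : 0 ≤ r) (hS : 0 ≤ S)
    (hΦ : ∀ s ∈ Set.Icc 0 t, |∫ y in Set.Ioi (0:ℝ), Φ s y ∂π| ≤ S) :
    |lyapOp π w M₁ Φ t r| ≤ 1 + (1 - w) * M₁ / (1 - w * M₁) * S := by
  set a := 1 - w * M₁
  have hk : 0 ≤ (1 - w) * M₁ := mul_nonneg (sub_nonneg.2 hw) hM₁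
  have hexp : Real.exp (-(a * r * t)) ≤ 1 := Real.exp_le_one_iff.2 (by
    have : 0 ≤ a * r * t := by positivity
    linarith)
  have hint : |∫ s in (0:ℝ)..t, Real.exp (-(a * r * (t - s))) *
      (∫ y in Set.Ioi (0:ℝ), Φ s y ∂π)| ≤
      ∫ s in (0:ℝ)..t, Real.exp (-(a * r * (t - s))) * S := by
    have hcont : Continuous fun s => Real.exp (-(a * r * (t - s))) * S := by fun_prop
    rw [← Real.norm_eq_abs]
    refine intervalIntegral.norm_integral_le_of_norm_le ht (.of_forall fun s hs => ?_)
      (hcont.intervalIntegrable 0 t)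
    rw [Real.norm_eq_abs, abs_mul, Real.abs_exp]
    gcongr
    exact hΦ s (Set.Ioc_subset_Icc_self hs)
  have hmass := integral_mul_exp_neg_le_one (a * r) t
  rw [intervalIntegral.integral_const_mul] at hmass
  rw [intervalIntegral.integral_mul_const] at hint
  calc |lyapOp π w M₁ Φ t r|
      ≤ Real.exp (-(a * r * t)) + (1 - w) * M₁ * r *
        |∫ s in (0:ℝ)..t, Real.exp (-(a * r * (t - s))) *
          (∫ y in Set.Ioi (0:ℝ), Φ s y ∂π)| := by
        refine (abs_add_le _ _).trans_eq ?_
        rw [Real.abs_exp, abs_mul, abs_of_nonneg (mul_nonneg hk hr)]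
    _ ≤ 1 + (1 - w) * M₁ * r * ((∫ s in (0:ℝ)..t, Real.exp (-(a * r * (t - s)))) * S) := by
        gcongr
    _ = 1 + (1 - w) * M₁ / a * (a * r * ∫ s in (0:ℝ)..t, Real.exp (-(a * r * (t - s)))) * S := by
        field_simp
    _ ≤ 1 + (1 - w) * M₁ / a * 1 * S := by gcongr
    _ = 1 + (1 - w) * M₁ / a * S := by rw [mul_one]

/-- A priori norm bound for solutions of the first Lyapunov equation:
`sup_{0≤t≤T} ∫ |E(t,r)| π(dr) ≤ (1-wM₁)/(1-M₁)`. -/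
theorem lyapunov_solution_norm_bound
    (π : Measure ℝ) [IsProbabilityMeasure π] (hπ : π (Set.Iic 0) = 0)
    (w : ℝ) (hw : w ∈ Set.Icc (0:ℝ) 1)
    (M₁ : ℝ) (hM₁ : M₁ ∈ Set.Ioo (0:ℝ) 1)
    (T : ℝ) (hT : 0 < T)
    (E : ℝ → ℝ → ℝ) (hmeas : Measurable (fun p : ℝ × ℝ => E p.1 p.2))
    (hfin : (⨆ t ∈ Set.Icc (0:ℝ) T,
        ∫⁻ r in Set.Ioi (0:ℝ), ENNReal.ofReal |E t r| ∂π) < ⊤)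
    (heq : ∀ t ∈ Set.Icc (0:ℝ) T, ∀ᵐ r ∂π, E t r = lyapOp π w M₁ E t r) :
    (⨆ t ∈ Set.Icc (0:ℝ) T,
        ∫⁻ r in Set.Ioi (0:ℝ), ENNReal.ofReal |E t r| ∂π)
      ≤ ENNReal.ofReal ((1 - w * M₁) / (1 - M₁)) := by
  obtain ⟨hM0, hM1⟩ := hM₁
  have ha : 0 < 1 - w * M₁ := by nlinarith [hw.1, hw.2]
  set L := ⨆ t ∈ Set.Icc (0:ℝ) T, ∫⁻ r in Set.Ioi (0:ℝ), ENNReal.ofReal |E t r| ∂π with hL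
  have hmass : ∀ s ∈ Set.Icc (0:ℝ) T, |∫ y in Set.Ioi (0:ℝ), E s y ∂π| ≤ L.toReal := by
    intro s hs
    rw [← Real.norm_eq_abs, ← toReal_enorm]
    refine ENNReal.toReal_mono hfin.ne ((enorm_integral_le_lintegral_enorm _).trans ?_)
    simp_rw [Real.enorm_eq_ofReal_abs]
    exact le_iSup₂ (f := fun t (_ : t ∈ Set.Icc (0:ℝ) T) =>
      ∫⁻ r in Set.Ioi (0:ℝ), ENNReal.ofReal |E t r| ∂π) s hs
  set C := 1 + (1 - w) * M₁ / (1 - w * M₁) * L.toReal with hC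
  have hLC : L ≤ ENNReal.ofReal C := by
    refine iSup₂_le fun t ht => ?_
    calc ∫⁻ r in Set.Ioi (0:ℝ), ENNReal.ofReal |E t r| ∂π
        ≤ ∫⁻ _ in Set.Ioi (0:ℝ), ENNReal.ofReal C ∂π := by
          refine lintegral_mono_ae ?_
          filter_upwards [ae_restrict_of_ae (heq t ht), ae_restrict_mem measurableSet_Ioi]
            with r hr hr0
          rw [hr]
          exact ENNReal.ofReal_le_ofReal (abs_lyapOp_le hw.2 hM0.le ha ht.1 (le_of_lt hr0)
            ENNReal.toReal_nonneg fun s hs => hmass s ⟨hs.1, hs.2.trans ht.2⟩)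
      _ ≤ ENNReal.ofReal C := by
          rw [setLIntegral_const]
          exact mul_le_of_le_one_right' prob_le_one
  have hk : 0 ≤ (1 - w) * M₁ / (1 - w * M₁) :=
    div_nonneg (mul_nonneg (sub_nonneg.2 hw.2) hM0.le) ha.le
  have hSC : L.toReal ≤ C := ENNReal.toReal_le_of_le_ofReal (by positivity) hLC
  rw [← ENNReal.ofReal_toReal hfin.ne]
  refine ENNReal.ofReal_le_ofReal ((le_div_iff₀ (sub_pos.2 hM1)).2 ?_)
  have hmul := mul_le_mul_of_nonneg_left hSC ha.le
  have hexpand : (1 - w * M₁) * C = (1 - w * M₁) + (1 - w) * M₁ * L.toReal := by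
    rw [hC]; field_simp
  linarith
end

section
/- Let π be a Borel probability measure on (0,∞), w ∈ [0,1], M₁ ∈ (0,1), T > 0, and let E : [0,T] × (0,∞) → ℝ be a measurable function satisfying sup_{0≤t≤T} ∫₀^∞ |E(t,r)| π(dr) ≤ (1−wM₁)/(1−M₁) and, for every t ∈ [0,T] and π-almost every r > 0, E(t,r) = e^{−(1−wM₁) r t} + (1−w) M₁ r ∫₀ᵗ e^{−(1−wM₁) r (t−s)} ( ∫₀^∞ E(s,y) π(dy) ) ds. Then |E(t,r)| ≤ (1−wM₁)/(1−M₁) for every t ∈ [0,T] and π-almost every r > 0. -/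
open MeasureTheory

/-- Exponential convolution with a function bounded by `C`. -/
theorem abs_integral_exp_mul_le {c C t : ℝ} {f : ℝ → ℝ} (hc : c ≠ 0) (ht : 0 ≤ t)
    (hf : ∀ s ∈ Set.Icc 0 t, |f s| ≤ C) :
    |∫ s in (0:ℝ)..t, Real.exp (-(c * (t - s))) * f s| ≤
      C * ((1 - Real.exp (-(c * t))) / c) := by
  have hderiv : ∀ s ∈ Set.uIcc 0 t,
      HasDerivAt (fun s => C * Real.exp (-(c * (t - s))) / c)
        (Real.exp (-(c * (t - s))) * C) s := by
    intro s _
    have h := ((((((hasDerivAt_id s).const_sub t).const_mul c).neg).exp).const_mul C).div_const c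
    refine h.congr_deriv ?_
    simp only [Pi.neg_apply, id]
    field_simp
  have hcont : Continuous fun s => Real.exp (-(c * (t - s))) * C := by fun_prop
  have hval := intervalIntegral.integral_eq_sub_of_hasDerivAt hderiv
    (hcont.intervalIntegrable 0 t)
  calc |∫ s in (0:ℝ)..t, Real.exp (-(c * (t - s))) * f s|
      ≤ ∫ s in (0:ℝ)..t, Real.exp (-(c * (t - s))) * C := by
        rw [← Real.norm_eq_abs]
        refine intervalIntegral.norm_integral_le_of_norm_le ht (ae_of_all _ fun s hs => ?_)
          (hcont.intervalIntegrable 0 t)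
        rw [norm_mul, Real.norm_eq_abs, Real.abs_exp, Real.norm_eq_abs]
        exact mul_le_mul_of_nonneg_left (hf s ⟨hs.1.le, hs.2⟩) (Real.exp_pos _).le
    _ = C * ((1 - Real.exp (-(c * t))) / c) := by
        rw [hval, sub_self, sub_zero, mul_zero, neg_zero, Real.exp_zero]
        ring

/-- Pointwise a priori bound for solutions of the first Lyapunov equation satisfying
the `L¹(π)`-norm bound: `|E(t,r)| ≤ (1-wM₁)/(1-M₁)` for every `t ∈ [0,T]` and
`π`-almost every `r`. -/
theorem lyapunov_solution_pointwise_bound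
    (π : Measure ℝ) [IsProbabilityMeasure π] (hπ : π (Set.Iic 0) = 0)
    (w : ℝ) (hw : w ∈ Set.Icc (0:ℝ) 1)
    (M₁ : ℝ) (hM₁ : M₁ ∈ Set.Ioo (0:ℝ) 1)
    (T : ℝ) (hT : 0 < T)
    (E : ℝ → ℝ → ℝ) (hmeas : Measurable (fun p : ℝ × ℝ => E p.1 p.2))
    (hint : ∀ t ∈ Set.Icc (0:ℝ) T, IntegrableOn (fun r => E t r) (Set.Ioi 0) π)
    (hnorm : ∀ t ∈ Set.Icc (0:ℝ) T,
      ∫ r in Set.Ioi (0:ℝ), |E t r| ∂π ≤ (1 - w * M₁) / (1 - M₁))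
    (heq : ∀ t ∈ Set.Icc (0:ℝ) T, ∀ᵐ r ∂π, E t r = lyapOp π w M₁ E t r) :
    ∀ t ∈ Set.Icc (0:ℝ) T, ∀ᵐ r ∂π, |E t r| ≤ (1 - w * M₁) / (1 - M₁) := by
  obtain ⟨hw0, hw1⟩ := hw
  obtain ⟨hM0, hM1⟩ := hM₁
  intro t ht
  have hpos : ∀ᵐ r ∂π, 0 < r := by
    simp only [ae_iff, not_lt]
    exact hπ
  filter_upwards [heq t ht, hpos] with r hr hr0
  have ha : 0 < 1 - w * M₁ := by nlinarith
  have hb : 0 ≤ (1 - w) * M₁ := mul_nonneg (by linarith) hM0.le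
  have hM : 0 < 1 - M₁ := by linarith
  have hac : 0 < (1 - w * M₁) * r := mul_pos ha hr0
  set C := (1 - w * M₁) / (1 - M₁) with hC
  have hmean : ∀ s ∈ Set.Icc (0:ℝ) T, |∫ y in Set.Ioi (0:ℝ), E s y ∂π| ≤ C := fun s hs =>
    (abs_integral_le_integral_abs).trans (hnorm s hs)
  have hconv := abs_integral_exp_mul_le hac.ne' ht.1
    (fun s hs => hmean s ⟨hs.1, hs.2.trans ht.2⟩)
  have hx0 := Real.exp_pos (-((1 - w * M₁) * r * t))
  have hx1 : Real.exp (-((1 - w * M₁) * r * t)) ≤ 1 :=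
    Real.exp_le_one_iff.mpr (by nlinarith [mul_nonneg hac.le ht.1])
  rw [hr, lyapOp]
  set x := Real.exp (-((1 - w * M₁) * r * t))
  have hscale : (1 - w) * M₁ * r * (C * ((1 - x) / ((1 - w * M₁) * r)))
      = (C - 1) * (1 - x) := by
    rw [hC]
    field_simp
    ring
  have hC1 : 1 ≤ C := by
    rw [hC, le_div_iff₀ hM]
    linarith
  refine (abs_add_le _ _).trans ?_
  rw [abs_of_pos hx0, abs_mul, abs_of_nonneg (mul_nonneg hb hr0.le)]
  have hle := mul_le_mul_of_nonneg_left hconv (mul_nonneg hb hr0.le)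
  rw [hscale] at hle
  nlinarith [mul_nonneg hx0.le (sub_nonneg.mpr hC1)]
end

section
/- Let ν be a σ-finite Borel measure on (0,∞) with M₁ = ∫₀^∞ z ν(dz) < ∞, let ρ be a Borel probability measure on (0,∞), w ∈ [0,1], θ ≥ 0, T > 0, and set φ̄ = θ/(1−M₁) (assuming M₁ < 1). If φ : [0,T] × (0,∞) → ℝ is bounded and continuous, and φ̂ = max(0, min(φ̄, φ)) denotes its truncation, then the function (t,r) ↦ θ·e^{−r t} + ∫₀ᵗ e^{−r(t−s)} r [ w ∫₀^∞ (1 − e^{−φ̂(s,r) z}) ν(dz) + (1−w) ∫₀^∞ ∫₀^∞ (1 − e^{−φ̂(s,u) z}) ν(dz) ρ(du) ] ds is bounded and continuous on [0,T] × (0,∞). -/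
open MeasureTheory

/-- The Riccati operator `𝔾` of the aggregation model. -/
noncomputable def riccatiOp (ν ρ : Measure ℝ) (w θ : ℝ)
    (φ : ℝ → ℝ → ℝ) (t r : ℝ) : ℝ :=
  θ * Real.exp (-(r * t)) +
    ∫ s in (0:ℝ)..t, Real.exp (-(r * (t - s))) * r *
      (w * (∫ z in Set.Ioi (0:ℝ), (1 - Real.exp (-(φ s r * z))) ∂ν) +
       (1 - w) * ∫ u in Set.Ioi (0:ℝ),
          (∫ z in Set.Ioi (0:ℝ), (1 - Real.exp (-(φ s u * z))) ∂ν) ∂ρ)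

/-- Truncation `φ̂ = max(0, min(c, φ))` at level `c`. -/
noncomputable def truncate (c : ℝ) (φ : ℝ → ℝ → ℝ) : ℝ → ℝ → ℝ :=
  fun t r => max 0 (min c (φ t r))

open Set

lemma abs_one_sub_exp_neg_le {x : ℝ} (hx : 0 ≤ x) : |1 - Real.exp (-x)| ≤ x := by
  have h₁ : Real.exp (-x) ≤ 1 := Real.exp_le_one_iff.2 (by linarith)
  have h₂ := Real.add_one_le_exp (-x)
  rw [abs_of_nonneg (by linarith)]
  linarith

lemma abs_one_sub_exp_neg_clamp_mul_le {c : ℝ} (hc : 0 ≤ c) (x : ℝ) {z : ℝ} (hz : 0 ≤ z) :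
    |1 - Real.exp (-(max 0 (min c x) * z))| ≤ c * z :=
  (abs_one_sub_exp_neg_le (mul_nonneg (le_max_left _ _) hz)).trans
    (mul_le_mul_of_nonneg_right (max_le hc (min_le_left _ _)) hz)

/-- The Laplace exponent `∫ (1 - e^{-xz}) ν(dz)`, evaluated at `x` clamped to `[0, c]`. -/
noncomputable def clampedExponent (ν : Measure ℝ) (c x : ℝ) : ℝ :=
  ∫ z in Ioi (0:ℝ), (1 - Real.exp (-(max 0 (min c x) * z))) ∂ν

lemma continuous_clampedExponent {ν : Measure ℝ}
    (hν : IntegrableOn (fun z : ℝ => z) (Ioi 0) ν) {c : ℝ} (hc : 0 ≤ c) :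
    Continuous (clampedExponent ν c) := by
  unfold clampedExponent
  refine continuous_of_dominated (bound := fun z => c * z) (fun x => ?_) (fun x => ?_)
    (hν.const_mul c) (ae_of_all _ fun z => by fun_prop)
  · exact Continuous.aestronglyMeasurable (by fun_prop)
  · exact (ae_restrict_mem measurableSet_Ioi).mono fun z hz =>
      abs_one_sub_exp_neg_clamp_mul_le hc x (le_of_lt hz)

lemma abs_clampedExponent_le {ν : Measure ℝ}
    (hν : IntegrableOn (fun z : ℝ => z) (Ioi 0) ν) {c : ℝ} (hc : 0 ≤ c) (x : ℝ) :
    |clampedExponent ν c x| ≤ c * ∫ z in Ioi (0:ℝ), z ∂ν := by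
  rw [← integral_const_mul, ← Real.norm_eq_abs]
  exact norm_integral_le_of_norm_le (hν.const_mul c)
    ((ae_restrict_mem measurableSet_Ioi).mono fun z hz =>
      abs_one_sub_exp_neg_clamp_mul_le hc x (le_of_lt hz))

lemma abs_integral_le_of_abs_le {ρ : Measure ℝ} [IsProbabilityMeasure ρ] {f : ℝ → ℝ} {K : ℝ}
    (hf : ∀ u, |f u| ≤ K) (s : Set ℝ) : |∫ u in s, f u ∂ρ| ≤ K := by
  have hK : 0 ≤ K := (abs_nonneg _).trans (hf 0)
  have h := norm_setIntegral_le_of_norm_le_const (f := f) (μ := ρ) (s := s) (C := K)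
    (measure_lt_top _ _) (fun u _ => hf u)
  exact h.trans (mul_le_of_le_one_right hK measureReal_le_one)

lemma abs_convex_comb_le {w a b K : ℝ} (hw : w ∈ Icc (0:ℝ) 1) (ha : |a| ≤ K) (hb : |b| ≤ K) :
    |w * a + (1 - w) * b| ≤ K := by
  rw [abs_le] at *
  obtain ⟨h0, h1⟩ := hw
  constructor <;> nlinarith

lemma integral_exp_neg_mul_sub (r t : ℝ) :
    ∫ s in (0:ℝ)..t, Real.exp (-(r * (t - s))) * r = 1 - Real.exp (-(r * t)) := by
  have h : ∀ s ∈ uIcc 0 t, HasDerivAt (fun s => Real.exp (-(r * (t - s))))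
      (Real.exp (-(r * (t - s))) * r) s := fun s _ => by
    have := (((hasDerivAt_id s).const_sub t).const_mul r).neg.exp
    simpa using this
  rw [intervalIntegral.integral_eq_sub_of_hasDerivAt h
    (Continuous.intervalIntegrable (by fun_prop) _ _)]
  simp

lemma abs_integral_exp_neg_mul_le {g : ℝ → ℝ} {K r t : ℝ} (hr : 0 ≤ r) (ht : 0 ≤ t)
    (hg : ∀ s, |g s| ≤ K) :
    |∫ s in (0:ℝ)..t, Real.exp (-(r * (t - s))) * r * g s| ≤ K := by
  have hK : 0 ≤ K := (abs_nonneg _).trans (hg 0)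
  have h := intervalIntegral.norm_integral_le_of_norm_le (μ := volume)
    (f := fun s => Real.exp (-(r * (t - s))) * r * g s)
    (g := fun s => Real.exp (-(r * (t - s))) * r * K) ht
    (ae_of_all _ fun s _ => by
      have h0 : 0 ≤ Real.exp (-(r * (t - s))) * r := by positivity
      rw [norm_mul, Real.norm_of_nonneg h0]
      exact mul_le_mul_of_nonneg_left (hg s) h0)
    (Continuous.intervalIntegrable (by fun_prop) _ _)
  rw [intervalIntegral.integral_mul_const, integral_exp_neg_mul_sub] at h
  exact h.trans (mul_le_of_le_one_left hK (by linarith [Real.exp_pos (-(r * t))]))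

/-- The truncated Riccati operator maps bounded continuous functions on
`[0,T] × (0,∞)` to bounded continuous functions on `[0,T] × (0,∞)`. -/
theorem truncated_riccatiOp_maps_Cb
    (ν ρ : Measure ℝ) [SigmaFinite ν] [IsProbabilityMeasure ρ]
    (hν : ν (Set.Iic 0) = 0) (hρ : ρ (Set.Iic 0) = 0)
    (hνInt : IntegrableOn (fun z : ℝ => z) (Set.Ioi 0) ν)
    (M₁ : ℝ) (hM₁ : M₁ = ∫ z in Set.Ioi (0:ℝ), z ∂ν) (hM₁lt : M₁ < 1)
    (w : ℝ) (hw : w ∈ Set.Icc (0:ℝ) 1)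
    (θ : ℝ) (hθ : 0 ≤ θ) (T : ℝ) (hT : 0 < T)
    (φ : ℝ → ℝ → ℝ)
    (hφc : ContinuousOn (fun p : ℝ × ℝ => φ p.1 p.2) (Set.Icc 0 T ×ˢ Set.Ioi 0))
    (hφb : ∃ C : ℝ, ∀ t ∈ Set.Icc (0:ℝ) T, ∀ r ∈ Set.Ioi (0:ℝ), |φ t r| ≤ C) :
    ContinuousOn
      (fun p : ℝ × ℝ =>
        riccatiOp ν ρ w θ (truncate (θ / (1 - M₁)) φ) p.1 p.2)
      (Set.Icc 0 T ×ˢ Set.Ioi 0) ∧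
    ∃ C : ℝ, ∀ t ∈ Set.Icc (0:ℝ) T, ∀ r ∈ Set.Ioi (0:ℝ),
      |riccatiOp ν ρ w θ (truncate (θ / (1 - M₁)) φ) t r| ≤ C := by
  set c := θ / (1 - M₁)
  have hc : 0 ≤ c := div_nonneg hθ (by linarith)
  set F := clampedExponent ν c
  have hFc : Continuous F := continuous_clampedExponent hνInt hc
  set K := c * ∫ z in Ioi (0:ℝ), z ∂ν
  have hFK : ∀ x, |F x| ≤ K := abs_clampedExponent_le hνInt hc
  have hform : ∀ t r, riccatiOp ν ρ w θ (truncate c φ) t r = θ * Real.exp (-(r * t)) +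
      ∫ s in (0:ℝ)..t, Real.exp (-(r * (t - s))) * r *
        (w * F (φ s r) + (1 - w) * ∫ u in Ioi (0:ℝ), F (φ s u) ∂ρ) := fun _ _ => rfl
  refine ⟨?_, θ + K, fun t ht r hr => ?_⟩
  · -- Extend `φ` in logarithmic coordinates to a continuous function on the whole plane.
    let g : ℝ → ℝ → ℝ := fun s y => F (φ (max 0 (min T s)) (Real.exp y))
    have hg : Continuous fun p : ℝ × ℝ => g p.1 p.2 :=
      hFc.comp <| hφc.comp_continuous
        (f := fun p : ℝ × ℝ => (max 0 (min T p.1), Real.exp p.2)) (by fun_prop)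
        fun p => ⟨⟨le_max_left _ _, max_le hT.le (min_le_left _ _)⟩, Real.exp_pos _⟩
    have hH : Continuous fun s => ∫ u in Ioi (0:ℝ), g s (Real.log u) ∂ρ := by
      refine continuous_of_dominated (bound := fun _ => K) (fun s => ?_)
        (fun s => ae_of_all _ fun u => hFK _) (integrable_const K)
        (ae_of_all _ fun u => hg.comp (by fun_prop : Continuous fun s => (s, Real.log u)))
      exact ((hg.comp (by fun_prop : Continuous fun y => (s, y))).measurable.comp
        Real.measurable_log).aestronglyMeasurable
    have hI : Continuous fun p : ℝ × ℝ => θ * Real.exp (-(Real.exp p.2 * p.1)) +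
        ∫ s in (0:ℝ)..p.1, Real.exp (-(Real.exp p.2 * (p.1 - s))) * Real.exp p.2 *
          (w * g s p.2 + (1 - w) * ∫ u in Ioi (0:ℝ), g s (Real.log u) ∂ρ) := by
      refine Continuous.add (by fun_prop)
        (intervalIntegral.continuous_parametric_intervalIntegral_of_continuous ?_ continuous_fst)
      have hg' : Continuous fun q : (ℝ × ℝ) × ℝ => g q.2 q.1.2 :=
        hg.comp (by fun_prop : Continuous fun q : (ℝ × ℝ) × ℝ => (q.2, q.1.2))
      have hH' := hH.comp (continuous_snd : Continuous fun q : (ℝ × ℝ) × ℝ => q.2)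
      exact Continuous.mul (by fun_prop)
        ((continuous_const.mul hg').add (continuous_const.mul hH'))
    have hlog : ContinuousOn (fun p : ℝ × ℝ => (p.1, Real.log p.2)) (Icc 0 T ×ˢ Ioi 0) :=
      continuousOn_fst.prodMk (continuousOn_snd.log fun p hp => (mem_Ioi.1 hp.2).ne')
    refine (hI.comp_continuousOn hlog).congr ?_
    rintro ⟨t, r⟩ ⟨ht, hr⟩
    simp only [hform, Function.comp, Real.exp_log (mem_Ioi.1 hr)]
    congr 1
    refine intervalIntegral.integral_congr fun s hs => ?_
    rw [uIcc_of_le ht.1] at hs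
    have hs' : max 0 (min T s) = s := by
      rw [min_eq_right (hs.2.trans ht.2), max_eq_right hs.1]
    have hu : ∫ u in Ioi (0:ℝ), g s (Real.log u) ∂ρ = ∫ u in Ioi (0:ℝ), F (φ s u) ∂ρ :=
      setIntegral_congr_fun measurableSet_Ioi fun u hu => by
        simp only [g, hs', Real.exp_log (mem_Ioi.1 hu)]
    simp only [hu]
    simp only [g, hs', Real.exp_log (mem_Ioi.1 hr)]
  · rw [hform]
    refine (abs_add_le _ _).trans (add_le_add ?_ ?_)
    · rw [abs_of_nonneg (by positivity)]
      exact mul_le_of_le_one_right hθ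
        (Real.exp_le_one_iff.2 (neg_nonpos.2 (mul_nonneg (le_of_lt hr) ht.1)))
    · exact abs_integral_exp_neg_mul_le (le_of_lt hr) ht.1 fun s =>
        abs_convex_comb_le hw (hFK _) (abs_integral_le_of_abs_le (fun u => hFK _) _)
end
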